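/- arXiv:1410.2626 — 3 statements merged into one kernel-verified Lean document; each statement's English description precedes it below -/
import Mathlib

section
/- For all integers m, n with |m| ≥ 2, |n| ≥ 2 and |m| ≠ |n|, the one-element set R = {t⁻¹ · aᵐ · t · a⁻ⁿ} in the free group F_2 on free generators a, t (the relator word of the Baumslag–Solitar group BS(m, n)) is not stable in permutations. Explicitly: there exists ε > 0 such that for every δ > 0 there exist a natural number N and permutations p_a, p_t ∈ Sym(N) with d_H(p_t⁻¹ ∘ p_aᵐ ∘ p_t ∘ p_a⁻ⁿ, id) < δ, while every pair q_a, q_t ∈ Sym(N) with q_t⁻¹ ∘ q_aᵐ ∘ q_t = q_aⁿ satisfies d_H(p_a, q_a) ≥ ε or d_H(p_t, q_t) ≥ ε. -/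
open Filter Topology

/-- The normalized Hamming distance between two permutations of `Fin n`
(interpreted as `0` when `n = 0`). -/
noncomputable def dH {n : ℕ} (p q : Equiv.Perm (Fin n)) : ℝ :=
  ((Finset.univ.filter fun i => p i ≠ q i).card : ℝ) / n

namespace BSaux

/-- left multiplication on every layer -/
def iota (G : Type) [Group G] (k : ℕ) : G →* Equiv.Perm (Fin (k+2) × G) where
  toFun g := Equiv.prodShear (Equiv.refl _) (fun _ => Equiv.mulLeft g)
  map_one' := by ext ⟨i, x⟩ <;> simp
  map_mul' a b := by ext ⟨i, x⟩ <;> simp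

lemma iota_apply {G : Type} [Group G] (k : ℕ) (g : G) (i : Fin (k+2)) (x : G) :
    iota G k g (i, x) = (i, g * x) := rfl

lemma iota_injective (G : Type) [Group G] (k : ℕ) : Function.Injective (iota G k) := by
  intro a b h
  have := congrArg (fun f => f ((0 : Fin (k+2)), (1 : G))) h
  simpa [iota_apply] using this

open Classical in
/-- rotate only the subgroup generated by `h` -/
noncomputable def gam {G : Type} [Group G] (h : G) : Equiv.Perm G where
  toFun x := if x ∈ Subgroup.zpowers h then h * x else x
  invFun x := if x ∈ Subgroup.zpowers h then h⁻¹ * x else x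
  left_inv x := by
    have hh := Subgroup.mem_zpowers h
    by_cases hx : x ∈ Subgroup.zpowers h <;> simp [hx, Subgroup.mul_mem_cancel_left _ hh]
  right_inv x := by
    have hh := Subgroup.mem_zpowers h
    by_cases hx : x ∈ Subgroup.zpowers h <;>
      simp [hx, Subgroup.mul_mem_cancel_left _ (Subgroup.inv_mem _ hh)]

lemma gam_mul {G : Type} [Group G] (h x : G) : gam h (h * x) = h * gam h x := by
  have hh := Subgroup.mem_zpowers h
  by_cases hx : x ∈ Subgroup.zpowers h <;>
    simp [gam, hx, Subgroup.mul_mem_cancel_left _ hh]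

/-- the untwisted root -/
def bet0 {G : Type} [Group G] (k : ℕ) (h : G) : Equiv.Perm (Fin (k+2) × G) :=
  Equiv.prodShear (finRotate (k+2)) (fun i => if i = Fin.last (k+1) then Equiv.mulLeft h else 1)

lemma bet0_lt {G : Type} [Group G] (k : ℕ) (h : G) (i : ℕ) (hi : i < k + 1) (x : G) :
    bet0 k h (⟨i, by omega⟩, x) = (⟨i+1, by omega⟩, x) := by
  have : (⟨i, by omega⟩ : Fin (k+2)) ≠ Fin.last (k+1) := by
    intro h; have := congrArg Fin.val h; simp at this; omega
  simp only [bet0, Equiv.prodShear, Equiv.coe_fn_mk, if_neg this, finRotate_of_lt hi]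
  rfl

lemma bet0_last {G : Type} [Group G] (k : ℕ) (h : G) (x : G) :
    bet0 k h (Fin.last (k+1), x) = (0, h * x) := by
  simp [bet0, Equiv.prodShear]

lemma bet0_iter {G : Type} [Group G] (k : ℕ) (h : G) (x : G) (i : ℕ) (hi : i < k + 2) :
    (bet0 k h ^ i) (0, x) = (⟨i, hi⟩, x) := by
  induction i with
  | zero => simp
  | succ i ih =>
    rw [pow_succ', Equiv.Perm.mul_apply, ih (by omega), bet0_lt k h i (by omega)]

lemma bet0_pow {G : Type} [Group G] (k : ℕ) (h : G) :
    bet0 k h ^ (k+2) = iota G k h := by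
  have h0 : ∀ x : G, (bet0 k h ^ (k+2)) (0, x) = (0, h * x) := by
    intro x
    rw [pow_succ', Equiv.Perm.mul_apply, bet0_iter k h x (k+1) (by omega)]
    exact bet0_last k h x
  refine Equiv.ext ?_
  rintro ⟨⟨i, hi⟩, x⟩
  rw [← bet0_iter k h x i hi, ← Equiv.Perm.mul_apply, ((Commute.refl (bet0 k h)).pow_pow (k+2) i).eq,
    Equiv.Perm.mul_apply, h0, bet0_iter k h _ i hi, bet0_iter k h _ i hi]
  rfl

/-- the twist on layer zero -/
noncomputable def cc {G : Type} [Group G] (k : ℕ) (h : G) : Equiv.Perm (Fin (k+2) × G) :=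
  Equiv.prodShear (Equiv.refl _) (fun i => if i = 0 then gam h else 1)

lemma cc_comm {G : Type} [Group G] (k : ℕ) (h : G) : Commute (cc k h) (iota G k h) := by
  refine Equiv.ext ?_
  rintro ⟨i, x⟩
  by_cases hi : i = 0 <;>
    simp [cc, Equiv.prodShear, iota_apply, hi, gam_mul]

lemma step {G : Type} [Group G] (k d : ℕ) (h g : G) (h1 : h ≠ 1)
    (hd : g ^ d ∉ Subgroup.zpowers h) :
    ∃ b : Equiv.Perm (Fin (k+2) × G), b ^ (k+2) = iota G k h ∧
      ¬ Commute (iota G k g ^ d) b := by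
  refine ⟨(cc k h)⁻¹ * bet0 k h * cc k h, ?_, ?_⟩
  · have := conj_pow (i := k+2) (a := (cc k h)⁻¹) (b := bet0 k h)
    rw [inv_inv] at this
    rw [this, bet0_pow, mul_assoc, ← (cc_comm k h).eq, inv_mul_cancel_left]
  · intro hc
    have key : ∀ x, ((cc k h)⁻¹ * bet0 k h * cc k h) (0, x) = (⟨1, by omega⟩, gam h x) := by
      intro x
      rw [Equiv.Perm.mul_apply, Equiv.Perm.mul_apply, Equiv.Perm.inv_eq_iff_eq]
      have : cc k h (0, x) = (⟨0, by omega⟩, gam h x) := by simp [cc, Equiv.prodShear]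
      rw [this, bet0_lt k h 0 (by omega)]
      simp [cc, Equiv.prodShear]
    rw [← map_pow] at hc
    generalize (cc k h)⁻¹ * bet0 k h * cc k h = b at hc key
    have := congrArg (fun f => f ((0 : Fin (k+2)), (1 : G))) hc.eq
    simp only [Equiv.Perm.mul_apply, key, iota_apply, mul_one] at this
    have := congrArg Prod.snd this
    simp [gam, hd, one_mem, h1] at this

lemma chain (m n : ℤ) (hm : 2 ≤ |m|) (hn : 2 ≤ |n|) (d : ℕ) (hd : ¬ n ∣ (d : ℤ)) (L : ℕ) :
    ∀ R : ℕ, ∃ (G : Type) (_ : Group G) (_ : Finite G) (g : ℕ → G),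
      (∀ j < L, g (j+1) ^ m = g j ^ n ∧ ¬ Commute (g j ^ d) (g (j+1))) ∧
      n.natAbs ^ R ∣ orderOf (g L) := by
  induction L with
  | zero =>
    intro R
    have : NeZero (n.natAbs ^ R) := ⟨by apply pow_ne_zero; intro h; simp at h; simp [h] at hn⟩
    refine ⟨Multiplicative (ZMod (n.natAbs ^ R)), inferInstance, inferInstance,
      fun _ => Multiplicative.ofAdd 1, by simp, ?_⟩
    simp [orderOf_ofAdd_eq_addOrderOf, ZMod.addOrderOf_one]
  | succ L ih =>
    intro R
    obtain ⟨G, _, _, g, hg, hR⟩ := ih (R+2)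
    obtain ⟨k, hk⟩ : ∃ k, m.natAbs = k + 2 := ⟨m.natAbs - 2, by rw [Int.abs_eq_natAbs] at hm; omega⟩
    have hN : 2 ≤ n.natAbs := by rw [Int.abs_eq_natAbs] at hn; omega
    have hsm : m.sign * m.sign = 1 := by
      have : m ≠ 0 := by rintro rfl; simp at hm
      rcases lt_or_gt_of_ne this with h | h
      · simp [Int.sign_eq_neg_one_of_neg h]
      · simp [Int.sign_eq_one_of_pos h]
    set h : G := g L ^ (n * m.sign) with hh
    have hNdvd : (n.natAbs : ℕ) ∣ orderOf (g L) := (dvd_pow_self _ (by omega)).trans hR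
    have hnotin : g L ^ d ∉ Subgroup.zpowers h := by
      rintro ⟨i, hi⟩
      apply hd
      simp only [hh] at hi
      rw [← zpow_mul, ← zpow_natCast, zpow_eq_zpow_iff_modEq] at hi
      have h2 := hi.dvd
      have h3 : n ∣ (d : ℤ) - n * m.sign * i :=
        (Int.natAbs_dvd.mp (Int.natCast_dvd_natCast.mpr hNdvd)).trans h2
      rw [mul_assoc] at h3
      exact (dvd_sub_left (dvd_mul_right _ _)).mp h3
    have hord : n.natAbs ^ (R+1) ∣ orderOf h := by
      have e1 : orderOf h = orderOf (g L ^ n.natAbs) := by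
        have a1 : orderOf h = orderOf (g L ^ n) := by
          apply Nat.dvd_antisymm
          · rw [hh, zpow_mul]; exact orderOf_dvd_of_mem_zpowers ⟨_, rfl⟩
          · have : g L ^ n = h ^ m.sign := by rw [hh, ← zpow_mul, mul_assoc, hsm, mul_one]
            rw [this]; exact orderOf_dvd_of_mem_zpowers ⟨_, rfl⟩
        rw [a1]
        rcases Int.natAbs_eq n with h | h
        · conv_lhs => rw [h]
          rw [zpow_natCast]
        · conv_lhs => rw [h]
          rw [zpow_neg, zpow_natCast, orderOf_inv]
      rw [e1, orderOf_pow_of_dvd (by omega) hNdvd]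
      apply Nat.dvd_div_of_mul_dvd
      rwa [← pow_succ']
    have h1 : h ≠ 1 := by
      intro h1
      rw [h1, orderOf_one, Nat.dvd_one, pow_succ] at hord
      have := Nat.eq_one_of_mul_eq_one_left hord
      omega
    obtain ⟨b, hb, hbc⟩ := step k d h (g L) h1 hnotin
    refine ⟨Equiv.Perm (Fin (k+2) × G), inferInstance, inferInstance,
      fun j => if j = L + 1 then b else iota G k (g j), ?_, ?_⟩
    · intro j hj
      by_cases hjL : j = L
      · subst hjL
        simp only [if_true, if_neg (show ¬ j = j + 1 by omega)]
        refine ⟨?_, hbc⟩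
        have : m = (k + 2 : ℕ) * m.sign := by
          rw [← hk]; rw [mul_comm]; exact (Int.sign_mul_natAbs m).symm
        conv_lhs => rw [this]
        rw [zpow_mul, zpow_natCast, hb, ← map_zpow, ← map_zpow, hh, ← zpow_mul, mul_assoc, hsm,
          mul_one]
      · obtain ⟨c1, c2⟩ := hg j (by omega)
        simp only [if_neg (show ¬ j = L + 1 by omega), if_neg (show ¬ j + 1 = L + 1 by omega)]
        refine ⟨by rw [← map_zpow, c1, map_zpow], ?_⟩
        rw [← map_pow]
        intro hc
        exact c2 (hc.of_map (iota_injective G k))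
    · simp only [if_true]
      have : orderOf h ∣ orderOf b := by
        rw [← orderOf_injective _ (iota_injective G k) h, ← hb]
        exact orderOf_pow_dvd _
      exact ((pow_dvd_pow _ (by omega)).trans hord).trans this

lemma finite_comm {G : Type} [Group G] [Finite G] (a t : G) (m n : ℤ) (h : t * a ^ n = a ^ m * t) :
    Commute (t * a ^ (Int.gcd m n) * t⁻¹) a := by
  have hc : t * a ^ n * t⁻¹ = a ^ m := by rw [h]; group
  have ho : orderOf (a ^ m) = orderOf (a ^ n) := by
    rw [← hc]
    exact orderOf_injective (MulAut.conj t).toMonoidHom (MulAut.conj t).injective _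
  have hz : ∀ z : ℤ, orderOf (a ^ z) = orderOf a / Nat.gcd (orderOf a) z.natAbs := by
    intro z
    rw [← orderOf_pow]
    rcases Int.natAbs_eq z with h | h
    · conv_lhs => rw [h]
      rw [zpow_natCast]
    · conv_lhs => rw [h]
      rw [zpow_neg, zpow_natCast, orderOf_inv]
  rw [hz, hz] at ho
  have hpos : 0 < orderOf a := orderOf_pos a
  have hg : Nat.gcd (orderOf a) m.natAbs = Nat.gcd (orderOf a) n.natAbs := by
    have e1 := Nat.div_mul_cancel (Nat.gcd_dvd_left (orderOf a) m.natAbs)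
    have e2 := Nat.div_mul_cancel (Nat.gcd_dvd_left (orderOf a) n.natAbs)
    rw [ho] at e1
    have : 0 < orderOf a / Nat.gcd (orderOf a) n.natAbs := by
      rcases Nat.eq_zero_or_pos (orderOf a / Nat.gcd (orderOf a) n.natAbs) with h | h
      · rw [h] at e2; omega
      · exact h
    exact Nat.eq_of_mul_eq_mul_left this (e1.trans e2.symm)
  have hgd : Nat.gcd (orderOf a) n.natAbs ∣ Int.gcd m n := by
    apply Nat.dvd_gcd
    · rw [← hg]; exact Nat.gcd_dvd_right _ _
    · exact Nat.gcd_dvd_right _ _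
  obtain ⟨c, hcc⟩ := hgd
  have hbez := Int.gcd_eq_gcd_ab (orderOf a : ℤ) n
  have hgg : Int.gcd (orderOf a : ℤ) n = Nat.gcd (orderOf a) n.natAbs := by simp [Int.gcd]
  set v := Int.gcdB (orderOf a : ℤ) n
  have key : a ^ (Int.gcd m n) = (a ^ n) ^ (v * c) := by
    rw [hcc, pow_mul, ← zpow_natCast a, ← hgg, hbez, zpow_add, zpow_mul a (orderOf a : ℤ),
      zpow_natCast, pow_orderOf_eq_one, one_zpow, one_mul, zpow_mul, zpow_mul, zpow_natCast]
  have : t * a ^ (Int.gcd m n) * t⁻¹ = (a ^ m) ^ (v * c) := by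
    rw [key, ← hc, conj_zpow]
  rw [this]
  exact ((Commute.refl a).zpow_left _).zpow_left _

section metric
variable {X : Type} [Fintype X] [DecidableEq X]

/-- unnormalized Hamming distance -/
def hD (p q : Equiv.Perm X) : ℕ := (Finset.univ.filter fun i => p i ≠ q i).card

lemma hD_comm (p q : Equiv.Perm X) : hD p q = hD q p := by
  simp only [hD, ne_comm]

lemma hD_tri (p q r : Equiv.Perm X) : hD p r ≤ hD p q + hD q r := by
  unfold hD
  refine le_trans (Finset.card_le_card ?_) (Finset.card_union_le _ _)
  intro i
  simp only [Finset.mem_filter, Finset.mem_univ, true_and, Finset.mem_union]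
  intro h
  by_contra hc
  push Not at hc
  exact h (hc.1.trans hc.2)

lemma hD_mul_left (r p q : Equiv.Perm X) : hD (r * p) (r * q) = hD p q := by
  simp [hD]

lemma hD_mul_right (r p q : Equiv.Perm X) : hD (p * r) (q * r) = hD p q := by
  unfold hD
  refine Finset.card_bij (fun i _ => r i) ?_ ?_ ?_
  · intro i hi; rw [Finset.mem_filter] at hi ⊢; simpa using hi
  · intro i _ j _ h; exact r.injective h
  · intro j hj
    refine ⟨r⁻¹ j, ?_, by simp⟩
    rw [Finset.mem_filter] at hj ⊢
    simpa using hj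

lemma hD_mul (p q p' q' : Equiv.Perm X) : hD (p * p') (q * q') ≤ hD p q + hD p' q' := by
  refine (hD_tri _ (q * p') _).trans ?_
  rw [hD_mul_right, hD_mul_left]

lemma hD_inv (p q : Equiv.Perm X) : hD p⁻¹ q⁻¹ = hD p q := by
  rw [← hD_mul_left p, ← hD_mul_right q, hD_comm]
  simp

lemma hD_pow (p q : Equiv.Perm X) (k : ℕ) : hD (p ^ k) (q ^ k) ≤ k * hD p q := by
  induction k with
  | zero => simp [hD]
  | succ k ih =>
    rw [pow_succ, pow_succ]
    have := hD_mul (p ^ k) (q ^ k) p q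
    linarith

lemma hD_word (a t a' t' : Equiv.Perm X) (d : ℕ) (h : Commute (t' * a' ^ d * t'⁻¹) a') :
    hD (t * a ^ d * t⁻¹ * a) (a * (t * a ^ d * t⁻¹)) ≤ 4 * hD t t' + (2 * d + 2) * hD a a' := by
  have h1 : hD (t * a ^ d * t⁻¹) (t' * a' ^ d * t'⁻¹) ≤ 2 * hD t t' + d * hD a a' := by
    have e1 := hD_mul (t * a ^ d) (t' * a' ^ d) t⁻¹ t'⁻¹
    have e2 := hD_mul t t' (a ^ d) (a' ^ d)
    have e3 := hD_pow a a' d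
    rw [hD_inv] at e1
    linarith
  generalize t * a ^ d * t⁻¹ = u at *
  generalize t' * a' ^ d * t'⁻¹ = u' at *
  have e1 := hD_tri (u * a) (u' * a') (a * u)
  have e2 := hD_mul u u' a a'
  have e3 := hD_mul a a' u u'
  rw [hD_comm] at e3
  rw [h.eq] at e1 e2
  linarith

lemma hD_congr {Y : Type} [Fintype Y] [DecidableEq Y] (e : X ≃ Y) (p q : Equiv.Perm X) :
    hD (e.permCongrHom p) (e.permCongrHom q) = hD p q := by
  unfold hD
  symm
  refine Finset.card_bij (fun i _ => e i) ?_ ?_ ?_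
  · intro i; simp [Equiv.permCongrHom]
  · intro i _ j _ h; exact e.injective h
  · intro j hj
    refine ⟨e.symm j, ?_, by simp⟩
    simpa [Equiv.permCongrHom] using hj

end metric

lemma dH_eq {N : ℕ} (p q : Equiv.Perm (Fin N)) : dH p q = (hD p q : ℝ) / N := rfl

/-- layered left multiplication -/
def lay (I G : Type) [Group G] : (I → G) →* Equiv.Perm (I × G) where
  toFun g := Equiv.prodShear (Equiv.refl _) (fun i => Equiv.mulLeft (g i))
  map_one' := by ext ⟨i, x⟩ <;> simp
  map_mul' a b := by ext ⟨i, x⟩ <;> simp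

lemma lay_apply {I G : Type} [Group G] (g : I → G) (i : I) (x : G) :
    lay I G g (i, x) = (i, g i * x) := rfl

/-- shift of layers -/
def shift (L : ℕ) (G : Type) : Equiv.Perm (Fin (L+1) × G) :=
  Equiv.prodCongr (finRotate (L+1)) (Equiv.refl G)

lemma shift_apply (L : ℕ) (G : Type) (j : ℕ) (hj : j < L) (x : G) :
    shift L G (⟨j, by omega⟩, x) = (⟨j+1, by omega⟩, x) := by
  simp only [shift, Equiv.prodCongr_apply, Prod.map, finRotate_of_lt hj]
  rfl

lemma card_layer (L : ℕ) (G : Type) [Fintype G] [DecidableEq G] (i : Fin (L+1)) :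
    (Finset.univ.filter fun x : Fin (L+1) × G => x.1 = i).card = Fintype.card G := by
  have : (Finset.univ.filter fun x : Fin (L+1) × G => x.1 = i) = {i} ×ˢ Finset.univ := by
    ext ⟨a, b⟩; simp [eq_comm]
  rw [this]; simp

lemma model (m n : ℤ) (hm : 2 ≤ |m|) (hn : 2 ≤ |n|) (d : ℕ) (hd : ¬ n ∣ (d : ℤ)) (L : ℕ) :
    ∃ (C : ℕ) (A T : Equiv.Perm (Fin ((L+1) * C))), 0 < C ∧
      hD (T * A ^ n) (A ^ m * T) ≤ C ∧
      L * C ≤ hD (T * A ^ d * T⁻¹ * A) (A * (T * A ^ d * T⁻¹)) := by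
  classical
  obtain ⟨G, _, _, g, hg, -⟩ := chain m n hm hn d hd L 0
  have := Fintype.ofFinite G
  let e : Fin (L+1) × G ≃ Fin ((L+1) * Fintype.card G) :=
    Fintype.equivFinOfCardEq (by simp)
  let A : Equiv.Perm (Fin (L+1) × G) := lay _ G (fun i => g i)
  let T := shift L G
  have hA : ∀ z : ℤ, ∀ i x, (A ^ z) (i, x) = (i, g i ^ z * x) := by
    intro z i x
    simp only [A, ← map_zpow, lay_apply, Pi.pow_apply]
  have hAd : ∀ i x, (A ^ d) (i, x) = (i, g i ^ d * x) := by
    intro i x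
    simp only [A, ← map_pow, lay_apply, Pi.pow_apply]
  have hA1 : ∀ i x, A (i, x) = (i, g i * x) := fun i x => rfl
  refine ⟨Fintype.card G, e.permCongrHom A, e.permCongrHom T, Fintype.card_pos, ?_, ?_⟩
  · simp only [← map_zpow, ← map_mul]
    rw [hD_congr, ← card_layer L G (Fin.last L)]
    apply Finset.card_le_card
    rintro ⟨⟨j, hj⟩, x⟩
    simp only [Finset.mem_filter, Finset.mem_univ, true_and]
    intro h
    by_contra hc
    have hjL : j < L := by
      rcases Nat.lt_or_ge j L with h | h
      · exact h
      · exact absurd (Fin.ext (by simp; omega)) hc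
    apply h
    rw [Equiv.Perm.mul_apply, Equiv.Perm.mul_apply, hA, shift_apply L G j hjL,
      shift_apply L G j hjL, hA]
    simp only [(hg j hjL).1]
  · simp only [← map_pow, ← map_inv, ← map_mul]
    rw [hD_congr]
    have h1 := Finset.card_filter_add_card_filter_not (s := (Finset.univ : Finset (Fin (L+1) × G)))
      (fun i => (T * A ^ d * T⁻¹ * A) i ≠ (A * (T * A ^ d * T⁻¹)) i)
    have h2 : (Finset.univ.filter fun i : Fin (L+1) × G =>
        ¬ ((T * A ^ d * T⁻¹ * A) i ≠ (A * (T * A ^ d * T⁻¹)) i)).card ≤ Fintype.card G := by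
      rw [← card_layer L G 0]
      apply Finset.card_le_card
      rintro ⟨⟨j, hj⟩, x⟩
      simp only [Finset.mem_filter, Finset.mem_univ, true_and, not_not]
      intro h
      by_contra hc
      obtain ⟨i, rfl⟩ : ∃ i, j = i + 1 := by
        cases j with
        | zero => exact absurd rfl hc
        | succ i => exact ⟨i, rfl⟩
      have hiL : i < L := by omega
      have hu : ∀ y, (T * A ^ d * T⁻¹) (⟨i+1, hj⟩, y) = (⟨i+1, hj⟩, g i ^ d * y) := by
        intro y
        have : T⁻¹ (⟨i+1, hj⟩, y) = (⟨i, by omega⟩, y) := by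
          rw [Equiv.Perm.inv_eq_iff_eq, shift_apply L G i hiL]
        rw [Equiv.Perm.mul_apply, Equiv.Perm.mul_apply, this, hAd, shift_apply L G i hiL]
      rw [Equiv.Perm.mul_apply, Equiv.Perm.mul_apply A, hA1, hu, hu, hA1] at h
      have h3 := congrArg Prod.snd h
      simp only [← mul_assoc] at h3
      exact (hg i hiL).2 (mul_right_cancel h3)
    rw [Finset.card_univ, Fintype.card_prod, Fintype.card_fin, add_mul, one_mul] at h1
    unfold hD
    omega

lemma core (m n : ℤ) (hm : 2 ≤ |m|) (hn : 2 ≤ |n|) (hnm : ¬ n ∣ m) :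
    ∃ ε : ℝ, 0 < ε ∧ ∀ δ : ℝ, 0 < δ →
      ∃ (N : ℕ) (pa pt : Equiv.Perm (Fin N)),
        dH (pt * pa ^ n) (pa ^ m * pt) < δ ∧
        ∀ qa qt : Equiv.Perm (Fin N),
          qt * qa ^ n = qa ^ m * qt →
          ε ≤ dH pa qa ∨ ε ≤ dH pt qt := by
  set d := Int.gcd m n with hdd
  have hd : ¬ n ∣ (d : ℤ) := fun h => hnm (h.trans (Int.gcd_dvd_left ..))
  refine ⟨1 / (2 * (2 * d + 6)), by positivity, fun δ hδ => ?_⟩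
  obtain ⟨L, hL⟩ := exists_nat_gt (1 / δ + 1)
  obtain ⟨C, A, T, hC, h1, h2⟩ := model m n hm hn d hd L
  refine ⟨_, A, T, ?_, ?_⟩
  · rw [dH_eq]
    have hC' : (0 : ℝ) < C := by exact_mod_cast hC
    have h1' : (hD (T * A ^ n) (A ^ m * T) : ℝ) ≤ C := by exact_mod_cast h1
    push_cast
    rw [div_lt_iff₀ (by positivity)]
    have : 1 < δ * (L + 1) := by
      have : 1 / δ < L + 1 := by linarith
      rwa [div_lt_iff₀' hδ] at this
    nlinarith
  · intro qa qt hq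
    by_contra hc
    push Not at hc
    obtain ⟨c1, c2⟩ := hc
    have h3 := hD_word A T qa qt d (finite_comm qa qt m n hq)
    have hC' : (0 : ℝ) < C := by exact_mod_cast hC
    have h4 : ((L * C : ℕ) : ℝ) ≤ ((4 * hD T qt + (2 * d + 2) * hD A qa : ℕ) : ℝ) := by
      exact_mod_cast h2.trans h3
    have hL1 : (1 : ℝ) ≤ L := by
      have : 0 < 1 / δ := by positivity
      linarith
    rw [dH_eq, div_lt_div_iff₀ (by positivity) (by positivity)] at c1 c2
    push_cast at c1 c2 h4
    have hdn : (0 : ℝ) ≤ d := by positivity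
    have k1 : 4 * ((hD T qt : ℝ) * (2 * (2 * d + 6))) + (2 * d + 2) * ((hD A qa : ℝ) * (2 * (2 * d + 6)))
        < 4 * (1 * ((L + 1) * C)) + (2 * d + 2) * (1 * ((L + 1) * C)) := by
      have := mul_lt_mul_of_pos_left c1 (show (0 : ℝ) < 2 * d + 2 by positivity)
      linarith
    have k2 : (L * C : ℝ) * (2 * (2 * d + 6)) < (2 * d + 6) * ((L + 1) * C) := by
      have := mul_le_mul_of_nonneg_right h4 (show (0 : ℝ) ≤ 2 * (2 * d + 6) by positivity)
      linarith
    have k3 : (L * C : ℝ) * 2 < (L + 1) * C := by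
      have : (2 * d + 6 : ℝ) * ((L * C : ℝ) * 2) < (2 * d + 6) * ((L + 1) * C) := by linarith
      exact lt_of_mul_lt_mul_left this (by positivity)
    nlinarith

end BSaux

/-- For `|m|, |n| ≥ 2` and `|m| ≠ |n|`, the relator word of the Baumslag–Solitar
group `BS(m, n)` is not stable in permutations. -/
theorem BS_m_n_not_stable (m n : ℤ) (hm : 2 ≤ |m|) (hn : 2 ≤ |n|)
    (hmn : |m| ≠ |n|) :
    ∃ ε : ℝ, 0 < ε ∧ ∀ δ : ℝ, 0 < δ →
      ∃ (N : ℕ) (pa pt : Equiv.Perm (Fin N)),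
        dH (pt⁻¹ * pa ^ m * pt * pa ^ (-n)) 1 < δ ∧
        ∀ qa qt : Equiv.Perm (Fin N),
          qt⁻¹ * qa ^ m * qt = qa ^ n →
          ε ≤ dH pa qa ∨ ε ≤ dH pt qt := by
  by_cases hnm : n ∣ m
  · have hmn' : ¬ m ∣ n := by
      intro h
      apply hmn
      rw [Int.abs_eq_natAbs, Int.abs_eq_natAbs, Int.natAbs_eq_of_dvd_dvd h hnm]
    obtain ⟨ε, hε, H⟩ := BSaux.core n m hn hm hmn'
    refine ⟨ε, hε, fun δ hδ => ?_⟩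
    obtain ⟨N, pa, pt, h1, h2⟩ := H δ hδ
    refine ⟨N, pa, pt⁻¹, ?_, ?_⟩
    · rw [BSaux.dH_eq] at h1 ⊢
      rw [← BSaux.hD_mul_right (pa ^ n * pt)]
      have e1 : (pt⁻¹)⁻¹ * pa ^ m * pt⁻¹ * pa ^ (-n) * (pa ^ n * pt) = pt * pa ^ m := by group
      rwa [e1, one_mul]
    · intro qa qt hq
      have := h2 qa qt⁻¹ (by rw [← hq]; group)
      rwa [BSaux.dH_eq pt, ← BSaux.hD_inv, inv_inv, ← BSaux.dH_eq] at this
  · obtain ⟨ε, hε, H⟩ := BSaux.core m n hm hn hnm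
    refine ⟨ε, hε, fun δ hδ => ?_⟩
    obtain ⟨N, pa, pt, h1, h2⟩ := H δ hδ
    refine ⟨N, pa, pt, ?_, ?_⟩
    · rw [BSaux.dH_eq] at h1 ⊢
      rw [← BSaux.hD_mul_right (pa ^ n), ← BSaux.hD_mul_left pt, BSaux.hD_comm]
      have e1 : pt * (pt⁻¹ * pa ^ m * pt * pa ^ (-n) * pa ^ n) = pa ^ m * pt := by group
      rwa [e1, one_mul]
    · intro qa qt hq
      exact h2 qa qt (by rw [← hq]; group)
end

section
/- Let R ⊆ F_m and R' ⊆ F_{m'} be finite sets of words such that the quotient groups F_m/⟨⟨R⟩⟩ and F_{m'}/⟨⟨R'⟩⟩ are isomorphic. Then R is stable in permutations if and only if R' is stable in permutations. -/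
open Filter Topology

/-- Evaluation of a word `ξ` of the free group on `m` generators at a tuple of
elements of a group `H`. -/
def evalWord {m : ℕ} {H : Type*} [Group H] (ξ : FreeGroup (Fin m)) (p : Fin m → H) : H :=
  FreeGroup.lift p ξ

/-- A finite set of words `R ⊆ F_m` is stable in permutations. -/
def IsStable {m : ℕ} (R : Finset (FreeGroup (Fin m))) : Prop :=
  ∀ ε : ℝ, 0 < ε → ∃ δ : ℝ, 0 < δ ∧
    ∀ (n : ℕ) (p : Fin m → Equiv.Perm (Fin n)),
      (∀ ξ ∈ R, dH (evalWord ξ p) 1 < δ) →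
      ∃ q : Fin m → Equiv.Perm (Fin n),
        (∀ ξ ∈ R, evalWord ξ q = 1) ∧ ∀ i, dH (p i) (q i) < ε

theorem dH_triangle {n : ℕ} (p q r : Equiv.Perm (Fin n)) : dH p r ≤ dH p q + dH q r := by
  unfold dH
  rw [← add_div]
  apply div_le_div_of_nonneg_right _ (Nat.cast_nonneg n)
  norm_cast
  refine le_trans (Finset.card_le_card ?_) (Finset.card_union_le _ _)
  intro i hi
  simp only [Finset.mem_filter, Finset.mem_univ, true_and, Finset.mem_union] at hi ⊢
  by_contra h
  push Not at h
  exact hi (h.1.trans h.2)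

theorem dH_self {n : ℕ} (p : Equiv.Perm (Fin n)) : dH p p = 0 := by
  simp [dH]

theorem dH_mul_left {n : ℕ} (a p q : Equiv.Perm (Fin n)) : dH (a * p) (a * q) = dH p q := by
  simp [dH]

theorem dH_mul_right {n : ℕ} (a p q : Equiv.Perm (Fin n)) : dH (p * a) (q * a) = dH p q := by
  unfold dH
  congr 2
  refine Finset.card_bij (fun i _ => a i) ?_ ?_ ?_
  · intro i hi
    exact Finset.mem_filter.2 ⟨Finset.mem_univ _, (Finset.mem_filter.1 hi).2⟩
  · intro i _ j _ h
    exact a.injective h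
  · intro j hj
    exact ⟨a⁻¹ j, Finset.mem_filter.2 ⟨Finset.mem_univ _, by simpa using (Finset.mem_filter.1 hj).2⟩,
      by simp⟩

theorem dH_comm {n : ℕ} (p q : Equiv.Perm (Fin n)) : dH p q = dH q p := by
  simp only [dH, ne_comm]

theorem dH_mul_le {n : ℕ} (a b c d : Equiv.Perm (Fin n)) :
    dH (a * b) (c * d) ≤ dH a c + dH b d := by
  refine (dH_triangle _ (c * b) _).trans ?_
  rw [dH_mul_left, dH_mul_right]

theorem dH_inv {n : ℕ} (a b : Equiv.Perm (Fin n)) : dH a⁻¹ b⁻¹ = dH a b := by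
  rw [← dH_mul_left a, ← dH_mul_right b]
  simp [dH_comm]

/-- Elements of the normal closure are almost killed by almost solutions. -/
theorem near_of_mem {m : ℕ} (R : Finset (FreeGroup (Fin m))) (x : FreeGroup (Fin m))
    (hx : x ∈ Subgroup.normalClosure (R : Set (FreeGroup (Fin m)))) :
    ∀ ε : ℝ, 0 < ε → ∀ᶠ δ in 𝓝[>] (0 : ℝ), ∀ (n : ℕ) (p : Fin m → Equiv.Perm (Fin n)),
      (∀ ξ ∈ R, dH (evalWord ξ p) 1 < δ) → dH (FreeGroup.lift p x) 1 < ε := by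
  unfold Subgroup.normalClosure at hx
  induction hx using Subgroup.closure_induction with
  | mem y hy =>
    intro ε hε
    obtain ⟨r, hr, c, hc⟩ := by
      simpa only [Group.mem_conjugatesOfSet_iff, isConj_iff] using hy
    filter_upwards [Ioo_mem_nhdsGT hε] with δ hδ n p hp
    have h1 := hp r hr
    have h2 : dH (FreeGroup.lift p y) 1 = dH (evalWord r p) 1 := by
      rw [← hc, map_mul, map_mul, map_inv,
        ← dH_mul_left (FreeGroup.lift p c) (evalWord r p),
        ← dH_mul_right (FreeGroup.lift p c)⁻¹ _ (FreeGroup.lift p c * 1)]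
      simp [evalWord]
    rw [h2]
    exact h1.trans hδ.2
  | one =>
    intro ε hε
    filter_upwards with δ n p hp
    simpa [dH_self] using hε
  | mul y z _ _ hy hz =>
    intro ε hε
    filter_upwards [hy (ε / 2) (half_pos hε), hz (ε / 2) (half_pos hε)] with δ h1 h2 n p hp
    have := dH_mul_le (FreeGroup.lift p y) (FreeGroup.lift p z) 1 1
    rw [mul_one] at this
    rw [map_mul]
    linarith [h1 n p hp, h2 n p hp]
  | inv y _ hy =>
    intro ε hε
    filter_upwards [hy ε hε] with δ h1 n p hp
    have := dH_inv (FreeGroup.lift p y) 1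
    rw [inv_one] at this
    rw [map_inv, this]
    exact h1 n p hp

/-- Words are uniformly continuous. -/
theorem near_of_near {m : ℕ} (x : FreeGroup (Fin m)) :
    ∀ ε : ℝ, 0 < ε → ∀ᶠ δ in 𝓝[>] (0 : ℝ), ∀ (n : ℕ) (p q : Fin m → Equiv.Perm (Fin n)),
      (∀ i, dH (p i) (q i) < δ) → dH (FreeGroup.lift p x) (FreeGroup.lift q x) < ε := by
  induction x using FreeGroup.induction_on with
  | C1 =>
    intro ε hε
    filter_upwards with δ n p q hp
    simpa [dH_self] using hε
  | of i =>
    intro ε hε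
    filter_upwards [Ioo_mem_nhdsGT hε] with δ hδ n p q hp
    simpa using (hp i).trans hδ.2
  | inv_of i hy =>
    intro ε hε
    filter_upwards [hy ε hε] with δ h1 n p q hp
    rw [map_inv, map_inv, dH_inv]
    exact h1 n p q hp
  | mul y z hy hz =>
    intro ε hε
    filter_upwards [hy (ε / 2) (half_pos hε), hz (ε / 2) (half_pos hε)] with δ h1 h2 n p q hp
    rw [map_mul, map_mul]
    linarith [h1 n p q hp, h2 n p q hp, dH_mul_le (FreeGroup.lift p y) (FreeGroup.lift p z)
      (FreeGroup.lift q y) (FreeGroup.lift q z)]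

/-- A homomorphism between presented groups lifts to the free groups. -/
theorem exists_lift {m : ℕ} {G H : Type*} [Group G] [Group H] (a : FreeGroup (Fin m) →* H)
    (b : G →* H) (hb : Function.Surjective b) :
    ∃ f : FreeGroup (Fin m) →* G, ∀ x, b (f x) = a x := by
  choose s hs using hb
  refine ⟨FreeGroup.lift fun i => s (a (FreeGroup.of i)), fun x => ?_⟩
  have : b.comp (FreeGroup.lift fun i => s (a (FreeGroup.of i))) = a := by
    ext i
    simp [hs]
  exact DFunLike.congr_fun this x

theorem stable_of_iso (m m' : ℕ)
    (R : Finset (FreeGroup (Fin m))) (R' : Finset (FreeGroup (Fin m')))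
    (e : (FreeGroup (Fin m) ⧸ Subgroup.normalClosure (R : Set (FreeGroup (Fin m)))) ≃*
        (FreeGroup (Fin m') ⧸ Subgroup.normalClosure (R' : Set (FreeGroup (Fin m')))))
    (hR : IsStable R) : IsStable R' := by
  obtain ⟨f, hf⟩ := exists_lift (e.toMonoidHom.comp (QuotientGroup.mk' _))
    (QuotientGroup.mk' (Subgroup.normalClosure (R' : Set (FreeGroup (Fin m')))))
    (QuotientGroup.mk'_surjective _)
  obtain ⟨g, hg⟩ := exists_lift (e.symm.toMonoidHom.comp (QuotientGroup.mk' _))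
    (QuotientGroup.mk' (Subgroup.normalClosure (R : Set (FreeGroup (Fin m)))))
    (QuotientGroup.mk'_surjective _)
  simp only [MonoidHom.comp_apply, QuotientGroup.mk'_apply, MulEquiv.toMonoidHom_eq_coe,
    MonoidHom.coe_coe] at hf hg
  have hfR : ∀ ξ ∈ R, f ξ ∈ Subgroup.normalClosure (R' : Set (FreeGroup (Fin m'))) := by
    intro ξ hξ
    have h := (QuotientGroup.eq_one_iff ξ).2 (Subgroup.subset_normalClosure hξ)
    rw [← QuotientGroup.eq_one_iff, hf, h, map_one]
  have hgR : ∀ ξ ∈ R', g ξ ∈ Subgroup.normalClosure (R : Set (FreeGroup (Fin m))) := by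
    intro ξ hξ
    have h := (QuotientGroup.eq_one_iff ξ).2 (Subgroup.subset_normalClosure hξ)
    rw [← QuotientGroup.eq_one_iff, hg, h, map_one]
  have hfg : ∀ y, y⁻¹ * f (g y) ∈ Subgroup.normalClosure (R' : Set (FreeGroup (Fin m'))) := by
    intro y
    rw [← QuotientGroup.eq, hf, hg, MulEquiv.apply_symm_apply]
  intro ε hε
  have hB : ∀ᶠ δ in 𝓝[>] (0 : ℝ), ∀ j : Fin m', ∀ (n : ℕ) (p q : Fin m → Equiv.Perm (Fin n)),
      (∀ i, dH (p i) (q i) < δ) → dH (FreeGroup.lift p (g (FreeGroup.of j)))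
        (FreeGroup.lift q (g (FreeGroup.of j))) < ε / 2 :=
    eventually_all.2 fun j => near_of_near _ _ (half_pos hε)
  obtain ⟨ε₁, hB, hε₁⟩ := (hB.and self_mem_nhdsWithin).exists
  obtain ⟨δ₁, hδ₁, hst⟩ := hR ε₁ hε₁
  have hA := (Finset.eventually_all R).2 fun ξ hξ => near_of_mem R' (f ξ) (hfR ξ hξ) δ₁ hδ₁
  have hC := eventually_all.2 fun j : Fin m' =>
    near_of_mem R' _ (hfg (FreeGroup.of j)) (ε / 2) (half_pos hε)
  obtain ⟨δ, ⟨hA, hC⟩, hδ⟩ := ((hA.and hC).and self_mem_nhdsWithin).exists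
  refine ⟨δ, hδ, fun n p' hp' => ?_⟩
  have hp : ∀ x, FreeGroup.lift (fun i => FreeGroup.lift p' (f (FreeGroup.of i))) x
      = FreeGroup.lift p' (f x) := by
    intro x
    have : FreeGroup.lift (fun i => FreeGroup.lift p' (f (FreeGroup.of i)))
        = (FreeGroup.lift p').comp f := by
      ext1 i
      simp
    exact DFunLike.congr_fun this x
  obtain ⟨q, hq, hpq⟩ := hst n (fun i => FreeGroup.lift p' (f (FreeGroup.of i))) (by
    intro ξ hξ
    rw [evalWord, hp]
    exact hA ξ hξ n p' hp')
  have hq' : ∀ y, FreeGroup.lift (fun j => FreeGroup.lift q (g (FreeGroup.of j))) y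
      = FreeGroup.lift q (g y) := by
    intro y
    have : FreeGroup.lift (fun j => FreeGroup.lift q (g (FreeGroup.of j)))
        = (FreeGroup.lift q).comp g := by
      ext1 i
      simp
    exact DFunLike.congr_fun this y
  have hker : Subgroup.normalClosure (R : Set (FreeGroup (Fin m))) ≤ (FreeGroup.lift q).ker :=
    Subgroup.normalClosure_le_normal fun ξ hξ => hq ξ hξ
  refine ⟨fun j => FreeGroup.lift q (g (FreeGroup.of j)), fun ξ hξ => ?_, fun j => ?_⟩
  · rw [evalWord, hq']
    exact hker (hgR ξ hξ)
  · have h1 := hB j n _ q hpq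
    rw [hp] at h1
    have h2 := hC j n p' hp'
    rw [← dH_mul_left (p' j), map_mul, map_inv, FreeGroup.lift_apply_of, mul_inv_cancel_left,
      mul_one, dH_comm] at h2
    linarith [dH_triangle (p' j) (FreeGroup.lift p' (f (g (FreeGroup.of j))))
      (FreeGroup.lift q (g (FreeGroup.of j)))]

/-- Stability does not depend on the finite presentation: if the presented
groups are isomorphic, then `R` is stable iff `R'` is stable. -/
theorem stability_presentation_independent (m m' : ℕ)
    (R : Finset (FreeGroup (Fin m))) (R' : Finset (FreeGroup (Fin m')))
    (hiso : Nonempty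
      ((FreeGroup (Fin m) ⧸ Subgroup.normalClosure (R : Set (FreeGroup (Fin m)))) ≃*
        (FreeGroup (Fin m') ⧸ Subgroup.normalClosure (R' : Set (FreeGroup (Fin m')))))) :
    IsStable R ↔ IsStable R' := by
  obtain ⟨e⟩ := hiso
  exact ⟨stable_of_iso m m' R R' e, stable_of_iso m' m R' R e.symm⟩
end

section
/- For every k ≥ 1 and every real ε > 0 there exists N ∈ ℕ such that for every n ≥ N and all pairwise commuting permutations p_1, …, p_k ∈ Sym(n) (p_i∘p_j = p_j∘p_i for all i, j), there exist pairwise commuting even permutations q_1, …, q_k ∈ Alt(n) with d_H(p_i, q_i) < ε for every i. -/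
open Filter Topology

/-- Dirichlet pigeonhole on the dual group. -/
lemma exists_small_char {A : Type*} [CommGroup A] [Finite A] (k B : ℕ) (hB : 1 ≤ B)
    (a : Fin k → A) (hcard : B ^ k < Nat.card A) :
    ∃ ψ : A → ZMod (Nat.card A), (∀ x y, ψ (x * y) = ψ x + ψ y) ∧ (∃ x, ψ x ≠ 0) ∧
      ∃ t : Fin k → ℤ, ∀ i, ψ (a i) = (t i : ZMod (Nat.card A)) ∧ B * |t i| ≤ Nat.card A := by
  classical
  have hN : Nat.card A ≠ 0 := by omega
  have : NeZero (Nat.card A) := ⟨hN⟩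
  have : NeZero (Monoid.exponent A) := ⟨Monoid.exponent_ne_zero_of_finite⟩
  have : NeZero ((Nat.card A : ℕ) : ℂ) := ⟨by exact_mod_cast hN⟩
  have : NeZero ((Monoid.exponent A : ℕ) : ℂ) :=
    ⟨by exact_mod_cast (Monoid.exponent_ne_zero_of_finite (G := A))⟩
  have hdual : Nat.card (A →* ℂˣ) = Nat.card A :=
    CommGroup.card_monoidHom_of_hasEnoughRootsOfUnity A ℂ
  have hroot : Nat.card (rootsOfUnity (Nat.card A) ℂ) = Nat.card A :=
    Complex.card_rootsOfUnity _
  have : Finite (A →* ℂˣ) := Nat.finite_of_card_ne_zero (by omega)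
  have : Fintype (A →* ℂˣ) := Fintype.ofFinite _
  obtain ⟨e⟩ : Nonempty (rootsOfUnity (Nat.card A) ℂ ≃* Multiplicative (ZMod (Nat.card A))) := by
    have h := (zmodCyclicMulEquiv (G := rootsOfUnity (Nat.card A) ℂ) inferInstance).symm
    rw [hroot] at h
    exact ⟨h⟩
  have hmem : ∀ (χ : A →* ℂˣ) (x : A), χ x ∈ rootsOfUnity (Nat.card A) ℂ := by
    intro χ x
    rw [mem_rootsOfUnity, ← map_pow, pow_card_eq_one', map_one]
  let J : (A →* ℂˣ) → A → ZMod (Nat.card A) := fun χ x => (e ⟨χ x, hmem χ x⟩).toAdd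
  have Jmul : ∀ χ x y, J χ (x * y) = J χ x + J χ y := by
    intro χ x y
    have : (⟨χ (x * y), hmem χ (x * y)⟩ : rootsOfUnity (Nat.card A) ℂ)
      = ⟨χ x, hmem χ x⟩ * ⟨χ y, hmem χ y⟩ := by ext; simp
    simp only [J]
    rw [this, map_mul, toAdd_mul]
  have Jinj : ∀ χ χ', (∀ x, J χ x = J χ' x) → χ = χ' := by
    intro χ χ' h
    ext x
    have := e.injective (Multiplicative.toAdd.injective (h x))
    have h2 := congrArg (fun z : rootsOfUnity (Nat.card A) ℂ => ((z : ℂˣ) : ℂ)) this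
    exact h2
  let box : (A →* ℂˣ) → (Fin k → Fin B) := fun χ i =>
    ⟨(J χ (a i)).val * B / Nat.card A, by
      rw [Nat.div_lt_iff_lt_mul (Nat.pos_of_ne_zero hN), mul_comm]
      exact Nat.mul_lt_mul_of_pos_left (ZMod.val_lt _) (by omega)⟩
  obtain ⟨χ, χ', hne, hbox⟩ := Fintype.exists_ne_map_eq_of_card_lt box (by
    rw [Fintype.card_fun, Fintype.card_fin, Fintype.card_fin, ← Nat.card_eq_fintype_card, hdual]
    exact hcard)
  refine ⟨fun x => J χ x - J χ' x, ?_, ?_, fun i => ((J χ (a i)).val : ℤ) - (J χ' (a i)).val, ?_⟩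
  · intro x y
    simp only [Jmul]; ring
  · by_contra! h
    exact hne (Jinj _ _ fun x => sub_eq_zero.mp (h x))
  · intro i
    refine ⟨by simp, ?_⟩
    have h1 := congrArg Fin.val (congrFun hbox i)
    simp only [box] at h1
    have e1 := Nat.div_add_mod ((J χ (a i)).val * B) (Nat.card A)
    have e2 := Nat.div_add_mod ((J χ' (a i)).val * B) (Nat.card A)
    have l1 := Nat.mod_lt ((J χ (a i)).val * B) (Nat.pos_of_ne_zero hN)
    have l2 := Nat.mod_lt ((J χ' (a i)).val * B) (Nat.pos_of_ne_zero hN)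
    rw [h1] at e1
    have : (B : ℤ) * |((J χ (a i)).val : ℤ) - (J χ' (a i)).val| =
      |(((J χ (a i)).val * B : ℕ) : ℤ) - ((J χ' (a i)).val * B : ℕ)| := by
      rw [← abs_of_nonneg (Int.natCast_nonneg B), ← abs_mul]
      push_cast
      congr 1; ring
    rw [this, abs_le]
    constructor <;> omega

/-- Normalized version: surjective onto `ZMod M` with small steps. -/
lemma exists_level_hom {A : Type*} [CommGroup A] [Finite A] (k B : ℕ) (hB : 1 ≤ B)
    (a : Fin k → A) (hgen : Subgroup.closure (Set.range a) = ⊤) (hcard : B ^ k < Nat.card A) :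
    ∃ M : ℕ, B ≤ M ∧ ∃ ψ : A → ZMod M, (∀ x y, ψ (x * y) = ψ x + ψ y) ∧
      Function.Surjective ψ ∧
      ∃ t : Fin k → ℤ, ∀ i, ψ (a i) = (t i : ZMod M) ∧ B * |t i| ≤ M := by
  classical
  obtain ⟨ψ, hmul, ⟨x0, hx0⟩, t, ht⟩ := exists_small_char k B hB a hcard
  generalize hNdef : Nat.card A = N at *
  have hN : 0 < N := by omega
  have : NeZero N := ⟨hN.ne'⟩
  have h1 : ψ 1 = 0 := by
    have := hmul 1 1
    simpa using this
  let H : AddSubgroup ℤ :=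
    { carrier := {z | ∃ x, ψ x = (z : ZMod N)}
      zero_mem' := ⟨1, by simp [h1]⟩
      add_mem' := by
        rintro y z ⟨u, hu⟩ ⟨v, hv⟩
        exact ⟨u * v, by rw [hmul, hu, hv]; push_cast; rfl⟩
      neg_mem' := by
        rintro y ⟨u, hu⟩
        refine ⟨u⁻¹, ?_⟩
        have := hmul u⁻¹ u
        rw [inv_mul_cancel, h1, hu] at this
        push_cast
        linear_combination -this }
  have Hmem : ∀ z : ℤ, z ∈ H ↔ ∃ x, ψ x = (z : ZMod N) := fun z => Iff.rfl
  obtain ⟨g0, hg0⟩ := Int.subgroup_cyclic H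
  have Hdvd : ∀ z : ℤ, z ∈ H ↔ ((g0.natAbs : ℕ) : ℤ) ∣ z := by
    intro z
    rw [hg0, ← AddSubgroup.zmultiples_eq_closure, Int.mem_zmultiples_iff, Int.natAbs_dvd]
  generalize g0.natAbs = g at Hdvd
  have hNH : (g : ℤ) ∣ (N : ℤ) := (Hdvd _).1 ((Hmem _).2 ⟨1, by simp [h1]⟩)
  obtain ⟨M, hM⟩ : g ∣ N := by exact_mod_cast hNH
  have hg : 0 < g := Nat.pos_of_ne_zero (by rintro rfl; simp at hM; omega)
  have hMpos : 0 < M := Nat.pos_of_ne_zero (by rintro rfl; simp at hM; omega)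
  have : NeZero M := ⟨hMpos.ne'⟩
  have hval : ∀ x, ∃ c : ℤ, ((ψ x).val : ℤ) = g * c := by
    intro x
    exact (Hdvd _).1 ((Hmem _).2 ⟨x, by simp⟩)
  choose c hc using hval
  -- key: if `ψ x = g * z` then `c x = z` in `ZMod M`
  have key : ∀ x (z : ℤ), ψ x = ((g * z : ℤ) : ZMod N) → ((c x : ℤ) : ZMod M) = z := by
    intro x z h
    have h2 : (((g * c x : ℤ)) : ZMod N) = ((g * z : ℤ) : ZMod N) := by
      rw [← hc, ← h]; simp
    rw [ZMod.intCast_eq_intCast_iff_dvd_sub] at h2 ⊢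
    rw [hM] at h2
    push_cast at h2
    rw [← mul_sub] at h2
    exact Int.dvd_of_mul_dvd_mul_left (by exact_mod_cast hg.ne') h2
  have hψc : ∀ x, ψ x = ((g * c x : ℤ) : ZMod N) := by
    intro x; rw [← hc]; simp
  have htg : ∀ i, ∃ s : ℤ, t i = g * s := fun i =>
    (Hdvd _).1 ((Hmem _).2 ⟨a i, (ht i).1⟩)
  choose s hs using htg
  have hsB : ∀ i, (B : ℤ) * |s i| ≤ M := by
    intro i
    have h := (ht i).2
    rw [hs, abs_mul, hM, abs_of_nonneg (Int.natCast_nonneg g)] at h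
    push_cast at h
    have hg' : (0 : ℤ) < g := by exact_mod_cast hg
    refine le_of_mul_le_mul_left ?_ hg'
    linarith
  refine ⟨M, ?_, fun x => (c x : ZMod M), ?_, ?_, s, fun i => ⟨?_, hsB i⟩⟩
  · by_contra! hlt
    have hs0 : ∀ i, s i = 0 := by
      intro i
      by_contra hne
      have : 1 ≤ |s i| := Int.one_le_abs hne
      have h2 := hsB i
      have : (B : ℤ) ≤ B * |s i| := by nlinarith
      omega
    have : ∀ x ∈ Subgroup.closure (Set.range a), ψ x = 0 := by
      intro x hx
      induction hx using Subgroup.closure_induction with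
      | mem x hx =>
        obtain ⟨i, rfl⟩ := hx
        rw [(ht i).1, hs, hs0]; simp
      | one => exact h1
      | mul x y _ _ hx hy => rw [hmul, hx, hy, add_zero]
      | inv x _ hx =>
        have := hmul x⁻¹ x
        rw [inv_mul_cancel, h1, hx, add_zero] at this
        exact this.symm
    exact hx0 (this x0 (by rw [hgen]; trivial))
  · intro x y
    have := key (x * y) (c x + c y) (by
      rw [hmul, hψc x, hψc y]; push_cast; ring)
    simpa using this
  · intro z
    obtain ⟨x, hx⟩ := (Hmem (g * (z.val : ℤ))).1 ((Hdvd _).2 ⟨_, rfl⟩)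
    exact ⟨x, by simpa using key x _ hx⟩
  · exact key _ _ (by rw [(ht i).1, hs])

/-- The cut-and-reglue construction on an invariant set with a level function. -/
lemma cut_reglue {X P : Type*} [Fintype X] [DecidableEq X] [CommGroup P] [MulAction P X]
    (O : Finset X) (hO : ∀ (g : P) x, x ∈ O → g • x ∈ O) (hne : O.Nonempty)
    (k B M : ℕ) (hB : 3 ≤ B) (hBM : B ≤ M)
    (ψ : P → ZMod M) (hψ : ∀ x y, ψ (x * y) = ψ x + ψ y) (hsurj : Function.Surjective ψ)
    (l : X → ZMod M) (hl : ∀ (g : P) x, x ∈ O → l (g • x) = ψ g + l x)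
    (a : Fin k → P) (t : Fin k → ℤ) (ht : ∀ i, ψ (a i) = (t i : ZMod M))
    (htB : ∀ i, B * |t i| ≤ M) :
    ∃ (p' : Fin k → Equiv.Perm X) (x y : X) (D : Finset X), x ≠ y ∧ x ∈ D ∧ y ∈ D ∧
      (∀ i, p' i x = x ∧ p' i y = y) ∧ (∀ i j, p' i * p' j = p' j * p' i) ∧
      (∀ i, ∀ z ∉ D, p' i z = a i • z) ∧ B * D.card ≤ 4 * O.card := by
  classical
  have : NeZero M := ⟨by omega⟩
  have ψ1 : ψ 1 = 0 := by
    have := hψ 1 1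
    simpa using this
  have ψinv : ∀ g, ψ g⁻¹ = - ψ g := by
    intro g
    have := hψ g⁻¹ g
    rw [inv_mul_cancel, ψ1] at this
    linear_combination -this
  obtain ⟨u, hu⟩ := hsurj 2
  have ψupow : ∀ n : ℕ, ψ (u ^ n) = 2 * n := by
    intro n
    induction n with
    | zero => simp [ψ1]
    | succ n ih => rw [pow_succ, hψ, ih, hu]; push_cast; ring
  have ψuz : ∀ z : ℤ, ψ (u ^ z) = 2 * z := by
    intro z
    obtain ⟨n, rfl | rfl⟩ := z.eq_nat_or_neg
    · simp [ψupow]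
    · simp [ψupow, ψinv]
  set m : ℤ := (M : ℤ) - 2 with hm
  have hmpos : 0 < m := by omega
  let lam : X → ℤ := fun x => ((l x).val : ℤ) - 2
  have llt : ∀ x, lam x < m := by
    intro x
    have := ZMod.val_lt (l x)
    simp only [lam]; omega
  have lcast : ∀ x, l x = ((lam x + 2 : ℤ) : ZMod M) := by
    intro x; simp [lam]
  let F : P → ℤ → X → X := fun g s x =>
    if x ∈ O then (if 0 ≤ lam x then (u ^ ((lam x + s) / m) * g) • x else x) else g • x
  have hO' : ∀ (g : P) x, x ∉ O → g • x ∉ O := by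
    intro g x hx h
    have := hO g⁻¹ _ h
    rw [inv_smul_smul] at this
    exact hx this
  have Flam : ∀ (g : P) (s : ℤ), ψ g = (s : ZMod M) → ∀ x ∈ O, 0 ≤ lam x →
      F g s x ∈ O ∧ lam (F g s x) = (lam x + s) % m := by
    intro g s hg x hx hlx
    simp only [F, hx, hlx, if_true]
    refine ⟨hO _ _ hx, ?_⟩
    have h1 : l ((u ^ ((lam x + s) / m) * g) • x) = (((lam x + s) % m + 2 : ℤ) : ZMod M) := by
      rw [hl _ _ hx, hψ, ψuz, hg, lcast x]
      have h2 := Int.mul_ediv_add_emod (lam x + s) m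
      have h3 : (lam x + s) % m + 2 + M * ((lam x + s) / m)
          = 2 * ((lam x + s) / m) + s + (lam x + 2) := by
        have : (M : ℤ) = m + 2 := by omega
        rw [this]; linarith
      have h4 := congrArg (Int.cast : ℤ → ZMod M) h3
      push_cast at h4 ⊢
      rw [ZMod.natCast_self, zero_mul, add_zero] at h4
      rw [h4]
    have hr0 := Int.emod_nonneg (lam x + s) hmpos.ne'
    have hr1 := Int.emod_lt_of_pos (lam x + s) hmpos
    have h5 : (((l ((u ^ ((lam x + s) / m) * g) • x)).val : ℕ) : ℤ) = (lam x + s) % m + 2 := by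
      rw [h1, ZMod.val_intCast, Int.emod_eq_of_lt] <;> omega
    simp only [lam] at h5 ⊢
    omega
  have Fcomp : ∀ (g : P) (s : ℤ) (h : P) (r : ℤ), ψ g = (s : ZMod M) → ∀ x,
      F h r (F g s x) = F (h * g) (r + s) x := by
    intro g s h r hg x
    by_cases hx : x ∈ O
    · by_cases hlx : 0 ≤ lam x
      · obtain ⟨h1, h2⟩ := Flam g s hg x hx hlx
        have h3 : 0 ≤ lam (F g s x) := by rw [h2]; exact Int.emod_nonneg _ hmpos.ne'
        have e1 : F h r (F g s x) = (u ^ ((lam (F g s x) + r) / m) * h) • F g s x := by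
          generalize F g s x = y at h1 h3
          simp only [F, h1, h3, if_true]
        have e2 : F g s x = (u ^ ((lam x + s) / m) * g) • x := by
          simp only [F, hx, hlx, if_true]
        have e3 : F (h * g) (r + s) x = (u ^ ((lam x + (r + s)) / m) * (h * g)) • x := by
          simp only [F, hx, hlx, if_true]
        rw [e1, h2, e2, e3, smul_smul]
        have e4 : (lam x + (r + s)) / m = ((lam x + s) % m + r) / m + (lam x + s) / m := by
          have h2 := Int.mul_ediv_add_emod (lam x + s) m
          rw [← Int.add_mul_ediv_left _ _ hmpos.ne']
          congr 1; linarith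
        rw [e4, zpow_add]
        congr 1
        simp only [mul_assoc, mul_left_comm, mul_comm]
      · simp only [F, hx, hlx, if_true, if_false]
    · simp only [F, hx, hO' _ _ hx, if_false, smul_smul]
  have F1 : ∀ x, F 1 0 x = x := by
    intro x
    by_cases hx : x ∈ O
    · by_cases hlx : 0 ≤ lam x
      · simp only [F, hx, hlx, if_true, add_zero]
        rw [Int.ediv_eq_zero_of_lt hlx (llt x)]; simp
      · simp only [F, hx, hlx, if_true, if_false]
    · simp [F, hx]
  let p' : Fin k → Equiv.Perm X := fun i =>
    { toFun := F (a i) (t i)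
      invFun := F (a i)⁻¹ (-t i)
      left_inv := fun x => by rw [Fcomp _ _ _ _ (ht i)]; simp [F1]
      right_inv := fun x => by
        rw [Fcomp _ _ _ _ (by rw [ψinv, ht]; simp)]; simp [F1] }
  have p'app : ∀ i x, p' i x = F (a i) (t i) x := fun i x => rfl
  let fib : ZMod M → Finset X := fun c => O.filter fun x => l x = c
  have hfib : ∀ c, (fib c).card = (fib 0).card := by
    intro c
    obtain ⟨g, hg⟩ := hsurj c
    symm
    refine Finset.card_bij (fun x _ => g • x) ?_ ?_ ?_
    · intro x hx
      simp only [fib, Finset.mem_filter] at hx ⊢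
      refine ⟨hO _ _ hx.1, by rw [hl _ _ hx.1, hg, hx.2, add_zero]⟩
    · intro x _ y _ h
      exact smul_left_cancel g h
    · intro x hx
      simp only [fib, Finset.mem_filter] at hx
      refine ⟨g⁻¹ • x, ?_, smul_inv_smul g x⟩
      simp only [fib, Finset.mem_filter]
      exact ⟨hO _ _ hx.1, by rw [hl _ _ hx.1, ψinv, hg, hx.2, neg_add_cancel]⟩
  have hsum : ∀ W : Finset (ZMod M),
      (O.filter fun x => l x ∈ W).card = W.card * (fib 0).card := by
    intro W
    rw [Finset.card_eq_sum_card_fiberwise (f := l) (t := W) (by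
      intro x hx; simp only [Finset.coe_filter, Set.mem_ofPred_eq] at hx; exact hx.2)]
    rw [← smul_eq_mul, ← Finset.sum_const]
    refine Finset.sum_congr rfl fun c hc => ?_
    rw [← hfib c]
    congr 1
    ext x
    simp only [fib, Finset.mem_filter]
    constructor
    · rintro ⟨⟨h1, _⟩, h2⟩; exact ⟨h1, h2⟩
    · rintro ⟨h1, h2⟩; exact ⟨⟨h1, h2 ▸ hc⟩, h2⟩
  have hOcard : O.card = M * (fib 0).card := by
    have := hsum Finset.univ
    simpa [ZMod.card] using this
  let T := M / B
  have hT : T * B ≤ M := Nat.div_mul_le_self M B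
  have htT : ∀ i, |t i| ≤ T := by
    intro i
    have h := htB i
    have : (t i).natAbs ≤ M / B := by
      rw [Nat.le_div_iff_mul_le (by omega)]
      rw [Int.abs_eq_natAbs] at h
      rw [mul_comm]
      exact_mod_cast h
    rw [Int.abs_eq_natAbs]
    exact_mod_cast this
  let W : Finset (ZMod M) := Finset.univ.filter fun c => c.val < 2 + T ∨ M - T ≤ c.val
  have hW : W.card ≤ 2 + 2 * T := by
    have h1 : W.card ≤ (Finset.range (2 + T) ∪ Finset.Ico (M - T) M).card := by
      refine Finset.card_le_card_of_injOn ZMod.val ?_ (ZMod.val_injective M).injOn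
      intro c hc
      have hc' := (Finset.mem_filter.1 hc).2
      have := ZMod.val_lt c
      simp only [Finset.coe_union, Finset.coe_range, Finset.coe_Ico, Set.mem_union, Set.mem_Iio,
        Set.mem_Ico]
      omega
    have h2 := Finset.card_union_le (Finset.range (2 + T)) (Finset.Ico (M - T) M)
    rw [Finset.card_range, Nat.card_Ico] at h2
    omega
  obtain ⟨o, ho⟩ := hne
  have hlev : ∀ c, ∃ x ∈ O, l x = c := by
    intro c
    obtain ⟨g, hg⟩ := hsurj (c - l o)
    exact ⟨g • o, hO _ _ ho, by rw [hl _ _ ho, hg]; ring⟩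
  obtain ⟨x, hxO, hx⟩ := hlev 0
  obtain ⟨y, hyO, hy⟩ := hlev 1
  have : Fact (1 < M) := ⟨by omega⟩
  have hlx : ¬ 0 ≤ lam x := by simp [lam, hx]
  have hly : ¬ 0 ≤ lam y := by simp only [lam, hy, ZMod.val_one]; norm_num
  refine ⟨p', x, y, O.filter fun x => l x ∈ W, ?_, ?_, ?_, ?_, ?_, ?_, ?_⟩
  · rintro rfl
    rw [hx] at hy
    exact zero_ne_one hy
  · simp [hxO, hx, W]
  · simp only [hyO, hy, W, ZMod.val_one, Finset.mem_filter, Finset.mem_univ, true_and]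
    omega
  · intro i
    refine ⟨?_, ?_⟩
    · rw [p'app]; simp only [F, hxO, hlx, if_true, if_false]
    · rw [p'app]; simp only [F, hyO, hly, if_true, if_false]
  · intro i j
    ext z
    rw [Equiv.Perm.mul_apply, Equiv.Perm.mul_apply, p'app, p'app, p'app, p'app,
      Fcomp _ _ _ _ (ht j), Fcomp _ _ _ _ (ht i), mul_comm, add_comm]
  · intro i z hz
    rw [p'app]
    by_cases hzO : z ∈ O
    · simp only [Finset.mem_filter, hzO, true_and, W, Finset.mem_univ, not_or, not_lt,
        not_le] at hz
      have h1 := abs_le.1 (htT i)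
      have h2 : 0 ≤ lam z := by simp only [lam]; omega
      have h3 : (lam z + t i) / m = 0 := by
        refine Int.ediv_eq_zero_of_lt ?_ ?_ <;> simp only [lam] <;> omega
      simp only [F, hzO, h2, if_true, h3, zpow_zero, one_mul]
    · simp only [F, hzO, if_false]
  · rw [hsum, hOcard]
    calc B * (W.card * (fib 0).card) = (B * W.card) * (fib 0).card := by ring
      _ ≤ (4 * M) * (fib 0).card := by
        apply Nat.mul_le_mul_right
        have := Nat.mul_le_mul_left B hW
        nlinarith
      _ = _ := by ring

/-- A large orbit can be modified on few points so as to create two common fixed points. -/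
lemma big_orbit {n k B : ℕ} (hB : 3 ≤ B) (p : Fin k → Equiv.Perm (Fin n))
    (hp : ∀ i j, p i * p j = p j * p i) (x0 : Fin n)
    (hbig : B ^ k < Nat.card (MulAction.orbit (Subgroup.closure (Set.range p)) x0)) :
    ∃ (p' : Fin k → Equiv.Perm (Fin n)) (x y : Fin n) (D : Finset (Fin n)),
      x ≠ y ∧ x ∈ D ∧ y ∈ D ∧
      (∀ i, p' i x = x ∧ p' i y = y) ∧ (∀ i j, p' i * p' j = p' j * p' i) ∧
      (∀ i, ∀ z ∉ D, p' i z = p i z) ∧ B * D.card ≤ 4 * n := by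
  classical
  have hcomm := Subgroup.isMulCommutative_closure (k := Set.range p) (by
    rintro _ ⟨i, rfl⟩ _ ⟨j, rfl⟩; exact hp i j)
  let _ : CommGroup (Subgroup.closure (Set.range p)) :=
    { (inferInstance : Group (Subgroup.closure (Set.range p))) with
      mul_comm := fun x y => hcomm.is_comm.comm x y }
  let P := Subgroup.closure (Set.range p)
  let S := MulAction.stabilizer P x0
  let a : Fin k → P := fun i => ⟨p i, Subgroup.subset_closure ⟨i, rfl⟩⟩
  have hcardA : Nat.card (P ⧸ S) = Nat.card (MulAction.orbit P x0) :=
    Nat.card_congr (MulAction.orbitEquivQuotientStabilizer P x0).symm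
  have hgen : Subgroup.closure (Set.range fun i => (QuotientGroup.mk (a i) : P ⧸ S)) = ⊤ := by
    rw [eq_top_iff]
    intro z hz
    clear hz
    obtain ⟨⟨g, hg⟩, rfl⟩ := QuotientGroup.mk_surjective z
    induction hg using Subgroup.closure_induction with
    | mem x hx =>
      obtain ⟨i, rfl⟩ := hx
      exact Subgroup.subset_closure ⟨i, rfl⟩
    | one => exact Subgroup.one_mem _
    | mul x y hx hy h1 h2 => exact Subgroup.mul_mem _ h1 h2
    | inv x hx h1 => exact Subgroup.inv_mem _ h1
  obtain ⟨M, hBM, ψ, hψ, hsurj, t, ht⟩ := exists_level_hom (A := P ⧸ S) k B (by omega)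
    (fun i => (QuotientGroup.mk (a i) : P ⧸ S)) hgen (by rw [hcardA]; exact hbig)
  let O : Finset (Fin n) := Finset.univ.filter fun x => ∃ g : P, g • x0 = x
  have memO : ∀ x, x ∈ O ↔ ∃ g : P, g • x0 = x := by intro x; simp [O]
  let l : Fin n → ZMod M := fun x =>
    if h : ∃ g : P, g • x0 = x then ψ (QuotientGroup.mk h.choose) else 0
  have hl0 : ∀ g : P, l (g • x0) = ψ (QuotientGroup.mk g) := by
    intro g
    have h : ∃ g' : P, g' • x0 = g • x0 := ⟨g, rfl⟩
    simp only [l]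
    rw [dif_pos h]
    congr 1
    rw [QuotientGroup.eq, MulAction.mem_stabilizer_iff, mul_smul, inv_smul_eq_iff]
    exact h.choose_spec.symm
  obtain ⟨p', x, y, D, hxy, hx, hy, hfix, hc, hD, hcard⟩ := cut_reglue (P := P) O (by
      intro g x hx
      obtain ⟨h, rfl⟩ := (memO _).1 hx
      exact (memO _).2 ⟨g * h, mul_smul _ _ _⟩) ⟨x0, (memO _).2 ⟨1, one_smul _ _⟩⟩
    k B M hB hBM (fun g => ψ (QuotientGroup.mk g)) (fun x y => hψ (QuotientGroup.mk x) (QuotientGroup.mk y))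
    (hsurj.comp QuotientGroup.mk_surjective) l (by
      intro g x hx
      obtain ⟨h, rfl⟩ := (memO _).1 hx
      rw [← mul_smul, hl0, hl0]
      exact hψ (QuotientGroup.mk g) (QuotientGroup.mk h)) a t (fun i => (ht i).1) (fun i => (ht i).2)
  refine ⟨p', x, y, D, hxy, hx, hy, hfix, hc, fun i z hz => hD i z hz, hcard.trans ?_⟩
  have := Finset.card_le_univ O
  rw [Fintype.card_fin] at this
  omega

/-- Making the action trivial on an invariant set. -/
lemma kill_set {n k : ℕ} (p : Fin k → Equiv.Perm (Fin n))
    (hp : ∀ i j, p i * p j = p j * p i) (D : Finset (Fin n))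
    (hD : ∀ i x, p i x ∈ D ↔ x ∈ D) :
    ∃ (p' : Fin k → Equiv.Perm (Fin n)), (∀ i, ∀ x ∈ D, p' i x = x) ∧
      (∀ i j, p' i * p' j = p' j * p' i) ∧ (∀ i, ∀ z ∉ D, p' i z = p i z) := by
  classical
  have hDi : ∀ i x, (p i).symm x ∈ D ↔ x ∈ D := by
    intro i x
    rw [← hD i, Equiv.apply_symm_apply]
  let p' : Fin k → Equiv.Perm (Fin n) := fun i =>
    { toFun := fun x => if x ∈ D then x else p i x
      invFun := fun x => if x ∈ D then x else (p i).symm x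
      left_inv := fun x => by by_cases h : x ∈ D <;> simp [h, hD]
      right_inv := fun x => by by_cases h : x ∈ D <;> simp [h, hDi] }
  have app : ∀ i x, p' i x = if x ∈ D then x else p i x := fun _ _ => rfl
  refine ⟨p', fun i x hx => by simp [app, hx], fun i j => ?_, fun i x hx => by simp [app, hx]⟩
  refine Equiv.ext fun x => ?_
  by_cases h : x ∈ D
  · simp [app, h]
  · have := congrArg (fun f : Equiv.Perm (Fin n) => f x) (hp i j)
    simpa [app, h, hD] using this

/-- With two common fixed points one can correct all signs. -/
lemma fix_signs {n k : ℕ} (p : Fin k → Equiv.Perm (Fin n))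
    (hp : ∀ i j, p i * p j = p j * p i) (x y : Fin n) (hxy : x ≠ y)
    (hfix : ∀ i, p i x = x ∧ p i y = y) :
    ∃ q : Fin k → Equiv.Perm (Fin n), (∀ i, Equiv.Perm.sign (q i) = 1) ∧
      (∀ i j, q i * q j = q j * q i) ∧ ∀ i z, z ≠ x → z ≠ y → q i z = p i z := by
  classical
  have hs : ∀ i, Commute (p i) (Equiv.swap x y) := by
    intro i
    have := Equiv.mul_swap_eq_swap_mul (p i) x y
    rw [(hfix i).1, (hfix i).2] at this
    exact this
  let e : Fin k → ℕ := fun i => if Equiv.Perm.sign (p i) = 1 then 0 else 1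
  refine ⟨fun i => p i * Equiv.swap x y ^ e i, fun i => ?_, fun i j => ?_, fun i z h1 h2 => ?_⟩
  · by_cases h : Equiv.Perm.sign (p i) = 1
    · simp [e, h]
    · have h' := (Int.units_eq_one_or (Equiv.Perm.sign (p i))).resolve_left h
      simp [e, h', Equiv.Perm.sign_swap hxy]
  · have h1 : Commute (p i) (p j) := hp i j
    have : Commute (p i * Equiv.swap x y ^ e i) (p j * Equiv.swap x y ^ e j) :=
      (h1.mul_right ((hs i).pow_right _)).mul_left
        (((hs j).symm.pow_left _).mul_right (Commute.pow_pow_self _ _ _))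
    exact this
  · by_cases h : Equiv.Perm.sign (p i) = 1
    · simp [e, h]
    · simp [e, h, Equiv.swap_apply_of_ne_of_ne h1 h2]

/-- For large enough `n`, every `k` commuting permutations of `Fin n` are near
`k` commuting even permutations. -/
theorem commuting_near_commuting_even (k : ℕ) (hk : 1 ≤ k) (ε : ℝ) (hε : 0 < ε) :
    ∃ N : ℕ, ∀ n : ℕ, N ≤ n →
      ∀ p : Fin k → Equiv.Perm (Fin n),
        (∀ i j, p i * p j = p j * p i) →
        ∃ q : Fin k → Equiv.Perm (Fin n),
          (∀ i, Equiv.Perm.sign (q i) = 1) ∧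
          (∀ i j, q i * q j = q j * q i) ∧
          ∀ i, dH (p i) (q i) < ε := by
  classical
  obtain ⟨B0, hB0⟩ := exists_nat_gt (4 / ε)
  obtain ⟨B, hB3, hBB⟩ : ∃ B : ℕ, 3 ≤ B ∧ B0 ≤ B := ⟨B0 + 3, by omega, by omega⟩
  have hBε : 4 < ε * B := by
    have : (4 / ε) < B := hB0.trans_le (by exact_mod_cast hBB)
    rw [div_lt_iff₀ hε] at this
    linarith
  obtain ⟨N0, hN0⟩ := exists_nat_gt ((2 * B ^ k : ℕ) / ε)
  refine ⟨N0 + 2, fun n hn p hp => ?_⟩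
  have hnpos : (0 : ℝ) < n := by
    have : 0 < n := by omega
    exact_mod_cast this
  have hnε : ((2 * B ^ k : ℕ) : ℝ) < ε * n := by
    have h1 : (N0 : ℝ) ≤ n := by exact_mod_cast (by omega : N0 ≤ n)
    have := hN0.trans_le h1
    rw [div_lt_iff₀ hε] at this
    linarith
  obtain ⟨p', x, y, D, hxy, hx, hy, hfix, hc, hD, hcard⟩ :
    ∃ (p' : Fin k → Equiv.Perm (Fin n)) (x y : Fin n) (D : Finset (Fin n)),
      x ≠ y ∧ x ∈ D ∧ y ∈ D ∧
      (∀ i, p' i x = x ∧ p' i y = y) ∧ (∀ i j, p' i * p' j = p' j * p' i) ∧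
      (∀ i, ∀ z ∉ D, p' i z = p i z) ∧ (D.card : ℝ) < ε * n := by
    by_cases hbig : ∃ x0 : Fin n, B ^ k <
        Nat.card (MulAction.orbit (Subgroup.closure (Set.range p)) x0)
    · obtain ⟨x0, hx0⟩ := hbig
      obtain ⟨p', x, y, D, hxy, hx, hy, hfix, hc, hD, hcard⟩ := big_orbit hB3 p hp x0 hx0
      refine ⟨p', x, y, D, hxy, hx, hy, hfix, hc, hD, ?_⟩
      have h1 : (B : ℝ) * D.card ≤ 4 * n := by exact_mod_cast hcard
      have hBpos : (0 : ℝ) < B := by exact_mod_cast (by omega : 0 < B)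
      refine lt_of_mul_lt_mul_left (h1.trans_lt ?_) hBpos.le
      nlinarith
    · push Not at hbig
      let G := Subgroup.closure (Set.range p)
      let x : Fin n := ⟨0, by omega⟩
      let y : Fin n := ⟨1, by omega⟩
      let D : Finset (Fin n) := (MulAction.orbit G x).toFinset ∪ (MulAction.orbit G y).toFinset
      have hxD : x ∈ D := by simp [D]
      have hyD : y ∈ D := by simp [D]
      have hinv : ∀ i z, p i z ∈ D ↔ z ∈ D := by
        intro i z
        have h : ∀ w : Fin n, p i z ∈ MulAction.orbit G w ↔ z ∈ MulAction.orbit G w := by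
          intro w
          let g : G := ⟨p i, Subgroup.subset_closure ⟨i, rfl⟩⟩
          change g • z ∈ MulAction.orbit G w ↔ _
          constructor
          · intro hz
            have := MulAction.mapsTo_smul_orbit g⁻¹ w hz
            simpa only [inv_smul_smul] using this
          · intro hz
            exact MulAction.mapsTo_smul_orbit g w hz
        simp only [D, Finset.mem_union, Set.mem_toFinset, h]
      obtain ⟨p', h1, h2, h3⟩ := kill_set p hp D hinv
      refine ⟨p', x, y, D, by simp [x, y], hxD, hyD, fun i => ⟨h1 i x hxD, h1 i y hyD⟩, h2, h3,
        lt_of_le_of_lt ?_ hnε⟩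
      have hcx := hbig x
      have hcy := hbig y
      rw [Nat.card_eq_card_toFinset] at hcx hcy
      have := Finset.card_union_le (MulAction.orbit G x).toFinset (MulAction.orbit G y).toFinset
      have h4 : D.card ≤ 2 * B ^ k := by
        refine this.trans ?_
        rw [two_mul]
        exact Nat.add_le_add hcx hcy
      exact_mod_cast h4
  obtain ⟨q, hq1, hq2, hq3⟩ := fix_signs p' hc x y hxy hfix
  refine ⟨q, hq1, hq2, fun i => ?_⟩
  unfold dH
  rw [div_lt_iff₀ hnpos]
  refine lt_of_le_of_lt ?_ hcard
  have : (Finset.univ.filter fun z => p i z ≠ q i z) ⊆ D := by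
    intro z hz
    by_contra hzD
    refine (Finset.mem_filter.1 hz).2 ?_
    rw [hq3 i z (by rintro rfl; exact hzD hx) (by rintro rfl; exact hzD hy), hD i z hzD]
  exact_mod_cast Finset.card_le_card this
end
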